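/- The angle function a tends to −∞ at +∞: for every K > 0 there exists α₀ > 0 such that a(α) < −K for all α ≥ α₀. -/

import Mathlib

open Set Filter

/-- `u` is a solution of the ODE `u'' + h u' + λ(|u|^{q-1} u - u) = 0`,
being C¹ on the closed set `S` (with derivative `u'`) and C² on `Sint`
(with second derivative `u''`), where the equation holds on `Sint`. -/
def SolOn (h : ℝ → ℝ) (lam q : ℝ) (S Sint : Set ℝ) (u u' u'' : ℝ → ℝ) : Prop :=
  (∀ t ∈ S, HasDerivWithinAt u (u' t) S t) ∧
  ContinuousOn u' S ∧
  (∀ t ∈ Sint, HasDerivWithinAt u' (u'' t) Sint t) ∧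
  ContinuousOn u'' Sint ∧
  (∀ t ∈ Sint, u'' t + h t * u' t + lam * (|u t| ^ (q - 1) * u t - u t) = 0)

/-- The Euclidean norm on ℝ². -/
noncomputable def enorm2 (p : ℝ × ℝ) : ℝ := Real.sqrt (p.1 ^ 2 + p.2 ^ 2)

/-- The nonlinearity `λ (|x|^{q-1} x - x)`. -/
noncomputable def nonlin (lam q x : ℝ) : ℝ := lam * (|x| ^ (q - 1) * x - x)

/-- The primitive of `nonlin` vanishing at `0`. -/
noncomputable def potential (lam q x : ℝ) : ℝ := lam * (|x| ^ (q + 1) / (q + 1) - x ^ 2 / 2)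

section Nonlinearity

variable {lam q : ℝ}

theorem abs_rpow_add_one (hq : 1 < q) (x : ℝ) : |x| ^ (q + 1) = |x| ^ (q - 1) * x ^ 2 := by
  have h1 : q + 1 = (q - 1) + 2 := by ring
  rw [h1, Real.rpow_add_of_nonneg (abs_nonneg x) (by linarith) (by norm_num), Real.rpow_two, sq_abs]

theorem potential_eq (hq : 1 < q) (x : ℝ) :
    potential lam q x = lam * (x ^ 2 * (|x| ^ (q - 1) / (q + 1) - 1 / 2)) := by
  rw [potential, abs_rpow_add_one hq]; ring

theorem nonlin_neg (x : ℝ) : nonlin lam q (-x) = -nonlin lam q x := by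
  simp only [nonlin, abs_neg]; ring

theorem hasDerivAt_potential (hq : 1 < q) (x : ℝ) :
    HasDerivAt (potential lam q) (nonlin lam q x) x := by
  have h1 := hasDerivAt_abs_rpow x (p := q + 1) (by linarith)
  have h2 := ((h1.div_const (q + 1)).sub ((hasDerivAt_pow 2 x).div_const 2)).const_mul lam
  refine h2.congr_deriv ?_
  have hq1 : q + 1 ≠ 0 := by linarith
  have : q + 1 - 2 = q - 1 := by ring
  rw [nonlin, this]
  field_simp
  simp
  ring

theorem exists_le_abs_rpow (hq : 1 < q) (C : ℝ) :
    ∃ M : ℝ, 0 < M ∧ ∀ x : ℝ, M ≤ |x| → C ≤ |x| ^ (q - 1) := by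
  have h1 := (tendsto_rpow_atTop (y := q - 1) (by linarith)).eventually_ge_atTop C
  obtain ⟨M, hM⟩ := eventually_atTop.1 h1
  exact ⟨max M 1, by positivity, fun x hx => hM _ ((le_max_left _ _).trans hx)⟩

theorem exists_neg_le_sq_mul (hq : 1 < q) {a : ℝ} (ha : 0 < a) (D : ℝ) :
    ∃ B : ℝ, 0 ≤ B ∧ ∀ x : ℝ, -B ≤ x ^ 2 * (a * |x| ^ (q - 1) - D) := by
  obtain ⟨M, hM0, hM⟩ := exists_le_abs_rpow hq (D / a)
  refine ⟨M ^ 2 * |D|, by positivity, fun x => ?_⟩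
  rcases le_total M |x| with hx | hx
  · have h1 := (div_le_iff₀' ha).1 (hM x hx)
    have : 0 ≤ x ^ 2 * (a * |x| ^ (q - 1) - D) := mul_nonneg (sq_nonneg _) (by linarith)
    have h2 : 0 ≤ M ^ 2 * |D| := by positivity
    linarith
  · have h1 : x ^ 2 ≤ M ^ 2 := by
      rw [← sq_abs x]; exact pow_le_pow_left₀ (abs_nonneg x) hx 2
    have h2 : 0 ≤ a * |x| ^ (q - 1) := by positivity
    have h3 : x ^ 2 * |D| ≤ M ^ 2 * |D| := mul_le_mul_of_nonneg_right h1 (abs_nonneg D)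
    have h4 : x ^ 2 * D ≤ x ^ 2 * |D| := mul_le_mul_of_nonneg_left (le_abs_self D) (sq_nonneg x)
    have h5 : 0 ≤ x ^ 2 * (a * |x| ^ (q - 1)) := mul_nonneg (sq_nonneg _) h2
    nlinarith

theorem exists_sq_le_potential_add (hlam : 0 < lam) (hq : 1 < q) :
    ∃ B : ℝ, 0 ≤ B ∧ ∀ x : ℝ, x ^ 2 ≤ potential lam q x + B := by
  obtain ⟨B, hB0, hB⟩ := exists_neg_le_sq_mul hq (a := lam / (q + 1))
    (div_pos hlam (by linarith)) (lam / 2 + 1)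
  refine ⟨B, hB0, fun x => ?_⟩
  have h1 : potential lam q x - x ^ 2
      = x ^ 2 * (lam / (q + 1) * |x| ^ (q - 1) - (lam / 2 + 1)) := by
    rw [potential_eq hq]; ring
  linarith [hB x]

theorem hasDerivAt_abs_rpow_mul_self (hq : 1 < q) (x : ℝ) :
    HasDerivAt (fun y : ℝ => |y| ^ (q - 1) * y) (q * |x| ^ (q - 1)) x := by
  rcases lt_trichotomy x 0 with hx | rfl | hx
  · have hx0 : x ≠ 0 := hx.ne
    have h1 : HasDerivAt (fun y : ℝ => (-y) ^ (q - 1) * y)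
        ((-1 * (q - 1) * (-x) ^ (q - 1 - 1)) * x + (-x) ^ (q - 1) * 1) x :=
      ((hasDerivAt_neg x).rpow_const (Or.inl (by linarith))).mul (hasDerivAt_id x)
    have h2 : (fun y : ℝ => |y| ^ (q - 1) * y) =ᶠ[nhds x] fun y => (-y) ^ (q - 1) * y := by
      filter_upwards [Iio_mem_nhds hx] with y hy
      rw [abs_of_neg hy]
    refine (h1.congr_of_eventuallyEq h2).congr_deriv ?_
    rw [abs_of_neg hx, Real.rpow_sub_one (by linarith)]
    field_simp
    ring
  · rw [hasDerivAt_iff_tendsto_slope]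
    have h1 : ContinuousAt (fun y : ℝ => |y| ^ (q - 1)) 0 :=
      continuous_abs.continuousAt.rpow_const (Or.inr (by linarith))
    have h2 : Tendsto (fun y : ℝ => |y| ^ (q - 1)) (nhdsWithin 0 {0}ᶜ)
        (nhds (q * |(0 : ℝ)| ^ (q - 1))) := by
      have h3 := h1.tendsto.mono_left (nhdsWithin_le_nhds (s := {0}ᶜ))
      have h4 : (0 : ℝ) ^ (q - 1) = 0 := Real.zero_rpow (by linarith)
      simpa [h4] using h3
    refine h2.congr' ?_
    filter_upwards [self_mem_nhdsWithin] with y hy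
    have hy' : y ≠ 0 := hy
    simp [slope_def_field, hy']
  · have h1 : HasDerivAt (fun y : ℝ => y ^ (q - 1) * y)
        ((1 * (q - 1) * x ^ (q - 1 - 1)) * x + x ^ (q - 1) * 1) x :=
      ((hasDerivAt_id x).rpow_const (Or.inl hx.ne')).mul (hasDerivAt_id x)
    have h2 : (fun y : ℝ => |y| ^ (q - 1) * y) =ᶠ[nhds x] fun y => y ^ (q - 1) * y := by
      filter_upwards [Ioi_mem_nhds hx] with y hy
      rw [abs_of_pos hy]
    refine (h1.congr_of_eventuallyEq h2).congr_deriv ?_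
    rw [abs_of_pos hx, Real.rpow_sub_one hx.ne']
    field_simp
    ring

theorem exists_nonlin_lipschitz (hlam : 0 < lam) (hq : 1 < q) (M : ℝ) :
    ∃ L : ℝ, 0 ≤ L ∧ ∀ x y : ℝ, |x| ≤ M → |y| ≤ M →
      |nonlin lam q x - nonlin lam q y| ≤ L * |x - y| := by
  refine ⟨lam * (q * |M| ^ (q - 1) + 1), by positivity, fun x y hx hy => ?_⟩
  have h1 : ∀ z ∈ Icc (-M) M, HasDerivWithinAt (nonlin lam q)
      (lam * (q * |z| ^ (q - 1) - 1)) (Icc (-M) M) z := fun z _ =>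
    (((hasDerivAt_abs_rpow_mul_self hq z).sub (hasDerivAt_id z)).const_mul lam).hasDerivWithinAt
  have h2 : ∀ z ∈ Icc (-M) M,
      ‖lam * (q * |z| ^ (q - 1) - 1)‖ ≤ lam * (q * |M| ^ (q - 1) + 1) := by
    intro z hz
    have hz' : |z| ≤ |M| := (abs_le.2 hz).trans (le_abs_self M)
    have h3 : |z| ^ (q - 1) ≤ |M| ^ (q - 1) :=
      Real.rpow_le_rpow (abs_nonneg z) hz' (by linarith)
    have h4 : 0 ≤ |z| ^ (q - 1) := by positivity
    rw [norm_mul, Real.norm_of_nonneg hlam.le, Real.norm_eq_abs]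
    refine mul_le_mul_of_nonneg_left (abs_le.2 ⟨?_, ?_⟩) hlam.le <;> nlinarith
  exact Convex.norm_image_sub_le_of_norm_hasDerivWithin_le h1 h2 (convex_Icc _ _)
    (abs_le.1 hy) (abs_le.1 hx)

end Nonlinearity

section Calculus

theorem antitoneOn_Icc_of_hasDerivAt {f f' : ℝ → ℝ} {a b : ℝ} (hc : ContinuousOn f (Icc a b))
    (hd : ∀ x ∈ Ioo a b, HasDerivAt f (f' x) x) (hle : ∀ x ∈ Ioo a b, f' x ≤ 0) :
    AntitoneOn f (Icc a b) := by
  refine antitoneOn_of_hasDerivWithinAt_nonpos (f' := f') (convex_Icc a b) hc ?_ ?_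
  · rw [interior_Icc]; exact fun x hx => (hd x hx).hasDerivWithinAt
  · rw [interior_Icc]; exact hle

theorem monotoneOn_Icc_of_hasDerivAt {f f' : ℝ → ℝ} {a b : ℝ} (hc : ContinuousOn f (Icc a b))
    (hd : ∀ x ∈ Ioo a b, HasDerivAt f (f' x) x) (hge : ∀ x ∈ Ioo a b, 0 ≤ f' x) :
    MonotoneOn f (Icc a b) := by
  refine monotoneOn_of_hasDerivWithinAt_nonneg (f' := f') (convex_Icc a b) hc ?_ ?_
  · rw [interior_Icc]; exact fun x hx => (hd x hx).hasDerivWithinAt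
  · rw [interior_Icc]; exact hge

theorem exists_primitive {h : ℝ → ℝ} {d c : ℝ} (hh : ContinuousOn h (Ioo 0 d))
    (hc : c ∈ Ioo 0 d) :
    ∃ P : ℝ → ℝ, P c = 0 ∧ ∀ t ∈ Ioo 0 d, HasDerivAt P (h t) t := by
  refine ⟨fun t => ∫ x in c..t, h x, by simp, fun t ht => ?_⟩
  have hsub : uIcc c t ⊆ Ioo 0 d := ordConnected_Ioo.uIcc_subset hc ht
  refine intervalIntegral.integral_hasDerivAt_right (hh.mono hsub).intervalIntegrable ?_ ?_
  · exact hh.stronglyMeasurableAtFilter isOpen_Ioo t ht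
  · exact hh.continuousAt (isOpen_Ioo.mem_nhds ht)

end Calculus

section Solution

variable {h u u' u'' v v' v'' : ℝ → ℝ} {lam q T t : ℝ}

theorem SolOn.hasDerivAt (hs : SolOn h lam q (Icc 0 T) (Ioc 0 T) u u' u'') (ht : t ∈ Ioo 0 T) :
    HasDerivAt u (u' t) t :=
  (hs.1 t (Ioo_subset_Icc_self ht)).hasDerivAt (Icc_mem_nhds ht.1 ht.2)

theorem SolOn.hasDerivAt_deriv (hs : SolOn h lam q (Icc 0 T) (Ioc 0 T) u u' u'')
    (ht : t ∈ Ioo 0 T) : HasDerivAt u' (-(h t * u' t) - nonlin lam q (u t)) t := by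
  have ht' := Ioo_subset_Ioc_self ht
  refine ((hs.2.2.1 t ht').hasDerivAt (Ioc_mem_nhds ht.1 ht.2)).congr_deriv ?_
  have := hs.2.2.2.2 t ht'
  rw [nonlin]; linarith

theorem SolOn.continuousOn (hs : SolOn h lam q (Icc 0 T) (Ioc 0 T) u u' u'') :
    ContinuousOn u (Icc 0 T) := fun t ht => (hs.1 t ht).continuousWithinAt

theorem SolOn.neg (hs : SolOn h lam q (Icc 0 T) (Ioc 0 T) u u' u'') :
    SolOn h lam q (Icc 0 T) (Ioc 0 T) (fun t => -u t) (fun t => -u' t) (fun t => -u'' t) := by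
  refine ⟨fun t ht => (hs.1 t ht).neg, hs.2.1.neg, fun t ht => (hs.2.2.1 t ht).neg,
    hs.2.2.2.1.neg, fun t ht => ?_⟩
  have := hs.2.2.2.2 t ht
  rw [abs_neg]
  linear_combination -this

theorem SolOn.energy_antitoneOn (hs : SolOn h lam q (Icc 0 T) (Ioc 0 T) u u' u'')
    (hq : 1 < q) (hh : ∀ t ∈ Ioo 0 T, 0 ≤ h t) :
    AntitoneOn (fun t => u' t ^ 2 / 2 + potential lam q (u t)) (Icc 0 T) := by
  have hpc : Continuous (potential lam q) :=
    continuous_iff_continuousAt.2 fun x => (hasDerivAt_potential hq x).continuousAt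
  refine antitoneOn_Icc_of_hasDerivAt (f' := fun t => -(h t * u' t ^ 2))
    (((hs.2.1.pow 2).div_const 2).add (hpc.comp_continuousOn hs.continuousOn)) ?_ ?_
  · intro t ht
    refine ((((hs.hasDerivAt_deriv ht).pow 2).div_const 2).add
      ((hasDerivAt_potential hq (u t)).comp t (hs.hasDerivAt ht))).congr_deriv ?_
    push_cast
    ring
  · intro t ht
    have := mul_nonneg (hh t ht) (sq_nonneg (u' t))
    linarith

theorem SolOn.dist_sq_le (hs : SolOn h lam q (Icc 0 T) (Ioc 0 T) u u' u'')
    (hs' : SolOn h lam q (Icc 0 T) (Ioc 0 T) v v' v'') (hh : ∀ t ∈ Ioo 0 T, 0 ≤ h t)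
    {L M : ℝ} (hL : 0 ≤ L)
    (hLip : ∀ x y : ℝ, |x| ≤ M → |y| ≤ M → |nonlin lam q x - nonlin lam q y| ≤ L * |x - y|)
    (hu : ∀ t ∈ Icc 0 T, |u t| ≤ M) (hv : ∀ t ∈ Icc 0 T, |v t| ≤ M) (ht : t ∈ Icc 0 T) :
    (u t - v t) ^ 2 + (u' t - v' t) ^ 2
      ≤ Real.exp ((1 + L) * T) * ((u 0 - v 0) ^ 2 + (u' 0 - v' 0) ^ 2) := by
  have hT : 0 ≤ T := ht.1.trans ht.2
  have hanti : AntitoneOn (fun t => ((u t - v t) ^ 2 + (u' t - v' t) ^ 2)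
      * Real.exp (-((1 + L) * t))) (Icc 0 T) := by
    refine antitoneOn_Icc_of_hasDerivAt (f' := fun t =>
      (2 * (u t - v t) * (u' t - v' t) + 2 * (u' t - v' t) *
        ((-(h t * u' t) - nonlin lam q (u t)) - (-(h t * v' t) - nonlin lam q (v t)))
        - (1 + L) * ((u t - v t) ^ 2 + (u' t - v' t) ^ 2)) * Real.exp (-((1 + L) * t))) ?_ ?_ ?_
    · refine ((((hs.continuousOn.sub hs'.continuousOn).pow 2).add
        ((hs.2.1.sub hs'.2.1).pow 2)).mul ?_)
      fun_prop
    · intro t ht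
      have h1 := ((hs.hasDerivAt ht).sub (hs'.hasDerivAt ht)).pow 2
      have h2 := ((hs.hasDerivAt_deriv ht).sub (hs'.hasDerivAt_deriv ht)).pow 2
      have h3 := (((hasDerivAt_id t).const_mul (1 + L)).neg).exp
      refine ((h1.add h2).mul h3).congr_deriv ?_
      simp only [Pi.sub_apply, Pi.add_apply, Pi.pow_apply, Pi.neg_apply, id]
      push_cast
      ring
    · intro t ht
      refine mul_nonpos_of_nonpos_of_nonneg ?_ (Real.exp_pos _).le
      have ht' := Ioo_subset_Icc_self ht
      have hl := hLip _ _ (hu t ht') (hv t ht')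
      have hh' := mul_nonneg (hh t ht) (sq_nonneg (u' t - v' t))
      have h4 : |(u' t - v' t) * (nonlin lam q (u t) - nonlin lam q (v t))|
          ≤ |u' t - v' t| * (L * |u t - v t|) := by
        rw [abs_mul]; exact mul_le_mul_of_nonneg_left hl (abs_nonneg _)
      have h5 := (abs_le.1 h4).1
      have h6 : 2 * (|u' t - v' t| * |u t - v t|) ≤ (u t - v t) ^ 2 + (u' t - v' t) ^ 2 := by
        rw [← sq_abs (u t - v t), ← sq_abs (u' t - v' t)]
        nlinarith [sq_nonneg (|u' t - v' t| - |u t - v t|)]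
      have h7 := mul_le_mul_of_nonneg_left h6 hL
      nlinarith [sq_nonneg ((u t - v t) - (u' t - v' t))]
  have h1 := hanti (left_mem_Icc.2 hT) ht ht.1
  simp only [mul_zero, neg_zero, Real.exp_zero, mul_one] at h1
  have h2 : (u t - v t) ^ 2 + (u' t - v' t) ^ 2
      = Real.exp ((1 + L) * t) * (((u t - v t) ^ 2 + (u' t - v' t) ^ 2)
        * Real.exp (-((1 + L) * t))) := by
    rw [mul_comm, mul_assoc, ← Real.exp_add]; simp
  rw [h2]
  refine mul_le_mul (Real.exp_le_exp.2 ?_) h1 (by positivity) (Real.exp_pos _).le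
  exact mul_le_mul_of_nonneg_left ht.2 (by linarith)

theorem SolOn.eq_zero_or_deriv_ne_zero {d : ℝ}
    (hs : SolOn h lam q (Icc 0 T) (Ioc 0 T) u u' u'') (hlam : 0 < lam) (hq : 1 < q)
    (hcont : ContinuousOn h (Ioo 0 d)) (hTd : T ∈ Ioo 0 d) (hh : ∀ t ∈ Ioo 0 T, 0 ≤ h t)
    (h0 : u 0 ≠ 0) (ht : t ∈ Icc 0 T) : ¬(u t = 0 ∧ u' t = 0) := by
  rintro ⟨hut, hu't⟩
  have ht0 : 0 < t := lt_of_le_of_ne ht.1 (fun h1 => h0 (h1 ▸ hut))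
  obtain ⟨P, -, hP⟩ := exists_primitive hcont hTd
  obtain ⟨M, hM⟩ := isCompact_Icc.exists_bound_of_continuousOn hs.continuousOn
  have hM0 : 0 ≤ M := (norm_nonneg _).trans (hM t ht)
  obtain ⟨L, hL0, hL⟩ := exists_nonlin_lipschitz hlam hq M
  have key : ∀ s ∈ Ioo 0 t, u s = 0 := by
    intro s hs0
    have hsub : ∀ x ∈ Icc s t, x ∈ Ioo 0 d := fun x hx =>
      ⟨hs0.1.trans_le hx.1, (hx.2.trans ht.2).trans_lt hTd.2⟩
    have hsubT : Icc s t ⊆ Icc 0 T := Icc_subset_Icc hs0.1.le ht.2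
    have hmono : MonotoneOn (fun x => (u x ^ 2 + u' x ^ 2)
        * Real.exp ((1 + L) * x + 2 * P x)) (Icc s t) := by
      refine monotoneOn_Icc_of_hasDerivAt (f' := fun x =>
        (2 * u x * u' x + 2 * u' x * (-(h x * u' x) - nonlin lam q (u x))
          + ((1 + L) + 2 * h x) * (u x ^ 2 + u' x ^ 2))
          * Real.exp ((1 + L) * x + 2 * P x)) ?_ ?_ ?_
      · have hPc : ContinuousOn P (Icc s t) := fun x hx =>
          (hP x (hsub x hx)).continuousAt.continuousWithinAt
        refine (((hs.continuousOn.mono hsubT).pow 2).add ((hs.2.1.mono hsubT).pow 2)).mul ?_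
        fun_prop
      · intro x hx
        have hx' : x ∈ Ioo 0 T := ⟨hs0.1.trans hx.1, hx.2.trans_le ht.2⟩
        have h1 := (hs.hasDerivAt hx').pow 2
        have h2 := (hs.hasDerivAt_deriv hx').pow 2
        have h3 := (((hasDerivAt_id x).const_mul (1 + L)).add
          ((hP x (hsub x (Ioo_subset_Icc_self hx))).const_mul 2)).exp
        refine ((h1.add h2).mul h3).congr_deriv ?_
        simp only [Pi.add_apply, Pi.pow_apply, id]
        push_cast
        ring
      · intro x hx
        refine mul_nonneg ?_ (Real.exp_pos _).le
        have hx' : x ∈ Ioo 0 T := ⟨hs0.1.trans hx.1, hx.2.trans_le ht.2⟩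
        have hl := hL (u x) 0 (hM x (Ioo_subset_Icc_self hx')) (by simpa using hM0)
        have hz : nonlin lam q 0 = 0 := by simp [nonlin]
        rw [hz, sub_zero, sub_zero] at hl
        have h4 : |u' x * nonlin lam q (u x)| ≤ |u' x| * (L * |u x|) := by
          rw [abs_mul]; exact mul_le_mul_of_nonneg_left hl (abs_nonneg _)
        have h5 := (abs_le.1 h4).2
        have h6 : 2 * (|u' x| * |u x|) ≤ u x ^ 2 + u' x ^ 2 := by
          rw [← sq_abs (u x), ← sq_abs (u' x)]
          nlinarith [sq_nonneg (|u' x| - |u x|)]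
        have h7 := mul_le_mul_of_nonneg_left h6 hL0
        have h8 := mul_nonneg (hh x hx') (sq_nonneg (u x))
        nlinarith [sq_nonneg (u x + u' x)]
    have h1 := hmono (left_mem_Icc.2 hs0.2.le) (right_mem_Icc.2 hs0.2.le) hs0.2.le
    simp only [hut, hu't] at h1
    have h2 : u s ^ 2 + u' s ^ 2 ≤ 0 := by
      by_contra hcon
      have := mul_pos (not_le.1 hcon) (Real.exp_pos ((1 + L) * s + 2 * P s))
      norm_num at h1
      linarith
    nlinarith [sq_nonneg (u s), sq_nonneg (u' s)]
  have h1 : Tendsto u (nhdsWithin 0 (Ioo 0 t)) (nhds (u 0)) :=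
    (hs.continuousOn 0 ⟨le_rfl, hTd.1.le⟩).mono
      (fun x hx => ⟨hx.1.le, hx.2.le.trans ht.2⟩)
  have h2 : Tendsto u (nhdsWithin 0 (Ioo 0 t)) (nhds 0) :=
    tendsto_const_nhds.congr' (by
      filter_upwards [self_mem_nhdsWithin] with x hx using (key x hx).symm)
  have : (nhdsWithin (0 : ℝ) (Ioo 0 t)).NeBot := by
    rw [nhdsWithin_Ioo_eq_nhdsGT ht0]; infer_instance
  exact h0 (tendsto_nhds_unique h1 h2)

end Solution

section Angle

theorem exists_continuous_exp_lift {z : ℝ × ℝ → ℂ} (hz : Continuous z) (hne : ∀ p, z p ≠ 0)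
    {p₀ : ℝ × ℝ} (hp₀ : z p₀ = 1) :
    ∃ g : ℝ × ℝ → ℂ, Continuous g ∧ g p₀ = 0 ∧ ∀ p, Complex.exp (g p) = z p := by
  let f : C(ℝ × ℝ, {w : ℂ // w ≠ 0}) := ⟨fun p => ⟨z p, hne p⟩, hz.subtype_mk _⟩
  obtain ⟨g, ⟨hg0, hg⟩, -⟩ := Complex.isCoveringMap_exp.existsUnique_continuousMap_lifts
    f p₀ 0 (Subtype.ext (by simp [f, hp₀]))
  exact ⟨g, g.continuous, hg0, fun p => congrArg Subtype.val (congrFun hg p)⟩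

theorem eq_zero_of_cos_eq_one {f : ℝ → ℝ} {a b : ℝ} (hf : ContinuousOn f (Icc a b))
    (hcos : ∀ x ∈ Icc a b, Real.cos (f x) = 1) (ha : f a = 0) {x : ℝ} (hx : x ∈ Icc a b) :
    f x = 0 := by
  by_contra hne
  have hpos : 0 < |f x| := abs_pos.2 hne
  have hc : ContinuousOn (fun y => |f y|) (Icc a x) :=
    (hf.mono (Icc_subset_Icc_right hx.2)).abs
  obtain ⟨y, hy, hyeq⟩ := intermediate_value_Icc hx.1 hc
    (show min |f x| Real.pi ∈ Icc |f a| |f x| by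
      rw [ha, abs_zero]; exact ⟨le_min (abs_nonneg _) Real.pi_pos.le, min_le_left _ _⟩)
  have h1 := hcos y ⟨hy.1, hy.2.trans hx.2⟩
  simp only at hyeq
  rw [← Real.cos_abs, hyeq] at h1
  have h2 : 0 < min |f x| Real.pi := lt_min hpos Real.pi_pos
  have h3 : min |f x| Real.pi ≤ Real.pi := min_le_right _ _
  have h4 := (Real.cos_eq_one_iff_of_lt_of_lt (by linarith [Real.pi_pos])
    (by linarith [Real.pi_pos])).1 h1
  linarith

/-- `Θ` is a continuous polar angle of the curve `(u, u')` on `[0, T]`. -/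
def IsAngleOn (T : ℝ) (u u' Θ : ℝ → ℝ) : Prop :=
  ContinuousOn Θ (Icc 0 T) ∧
    ∀ t ∈ Icc 0 T, ∃ r : ℝ, 0 < r ∧ u t = r * Real.cos (Θ t) ∧ u' t = r * Real.sin (Θ t)

variable {h u u' u'' Θ : ℝ → ℝ} {lam q T s t : ℝ}

theorem IsAngleOn.neg (hΘ : IsAngleOn T u u' Θ) :
    IsAngleOn T (fun t => -u t) (fun t => -u' t) (fun t => Θ t + Real.pi) := by
  refine ⟨hΘ.1.add continuousOn_const, fun t ht => ?_⟩
  obtain ⟨r, hr, h1, h2⟩ := hΘ.2 t ht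
  refine ⟨r, hr, ?_, ?_⟩
  · simp only [Real.cos_add_pi, h1]; ring
  · simp only [Real.sin_add_pi, h2]; ring

theorem IsAngleOn.lt_pi_div_two (hΘ : IsAngleOn T u u' Θ)
    (hu : ∀ t ∈ Icc 0 T, HasDerivWithinAt u (u' t) (Icc 0 T) t)
    (hs0 : 0 ≤ s) (hst : s ≤ t) (htT : t ≤ T) (hs : Θ s < Real.pi / 2) :
    Θ t < Real.pi / 2 := by
  by_contra! hcon
  have hsub : Icc s t ⊆ Icc 0 T := Icc_subset_Icc hs0 htT
  have hΘc : ContinuousOn Θ (Icc s t) := hΘ.1.mono hsub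
  have hcl : IsClosed (Icc s t ∩ Θ ⁻¹' Ici (Real.pi / 2)) :=
    hΘc.preimage_isClosed_of_isClosed isClosed_Icc isClosed_Ici
  obtain ⟨x, ⟨hxI, hxΘ⟩, hxmin⟩ :=
    (isCompact_Icc.of_isClosed_subset hcl inter_subset_left).exists_isLeast
      ⟨t, right_mem_Icc.2 hst, hcon⟩
  have hxΘ : Real.pi / 2 ≤ Θ x := hxΘ
  have hsx : s < x := lt_of_le_of_ne hxI.1 (fun h1 => by rw [← h1] at hxΘ; linarith)
  obtain ⟨y, hy, hyΘ⟩ := intermediate_value_Icc hsx.le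
    (hΘc.mono (Icc_subset_Icc_right hxI.2)) (show Real.pi / 2 ∈ Icc (Θ s) (Θ x) from ⟨hs.le, hxΘ⟩)
  have hyx : x = y :=
    le_antisymm (hxmin ⟨⟨hy.1, hy.2.trans hxI.2⟩, hyΘ.ge⟩) hy.2
  subst hyx
  obtain ⟨r, hr, h1, h2⟩ := hΘ.2 x (hsub hxI)
  rw [hyΘ, Real.cos_pi_div_two, mul_zero] at h1
  rw [hyΘ, Real.sin_pi_div_two, mul_one] at h2
  have hder : HasDerivWithinAt u (u' x) (Ioo s x) x := (hu x (hsub hxI)).mono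
    (fun y hy => hsub ⟨hy.1.le, hy.2.le.trans hxI.2⟩)
  rw [hasDerivWithinAt_iff_tendsto_slope' (fun hx => lt_irrefl _ hx.2)] at hder
  have : (nhdsWithin x (Ioo s x)).NeBot := by
    rw [nhdsWithin_Ioo_eq_nhdsLT hsx]; infer_instance
  have hlow : ∀ᶠ y in nhdsWithin x (Ioo s x), -(Real.pi / 2) < Θ y := by
    have h3 : Tendsto Θ (nhdsWithin x (Ioo s x)) (nhds (Θ x)) :=
      (hΘc x hxI).mono (fun y hy => ⟨hy.1.le, hy.2.le.trans hxI.2⟩)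
    refine h3.eventually_const_lt ?_
    rw [hyΘ]; linarith [Real.pi_pos]
  have hle : u' x ≤ 0 := by
    refine le_of_tendsto hder ?_
    filter_upwards [hlow, self_mem_nhdsWithin] with y hy1 hy2
    have hyI : y ∈ Icc s t := ⟨hy2.1.le, hy2.2.le.trans hxI.2⟩
    have hy3 : Θ y < Real.pi / 2 := by
      by_contra! h3
      exact absurd (hxmin ⟨hyI, h3⟩) (not_le.2 hy2.2)
    obtain ⟨ρ, hρ, h4, -⟩ := hΘ.2 y (hsub hyI)
    have h5 : 0 < u y := by
      rw [h4]; exact mul_pos hρ (Real.cos_pos_of_mem_Ioo ⟨hy1, hy3⟩)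
    rw [slope_def_field, h1]
    exact div_nonpos_of_nonneg_of_nonpos (by linarith) (by linarith [hy2.2])
  linarith

theorem IsAngleOn.exists_lt_neg_pi_div_two (hΘ : IsAngleOn T u u' Θ)
    (hsol : SolOn h lam q (Icc 0 T) (Ioc 0 T) u u' u'') {τ ω : ℝ} (hτ : 0 < τ) (hω : 0 < ω)
    (hωτ : 8 * Real.pi ≤ ω * τ) (hs0 : 0 ≤ s) (hsT : s + τ ≤ T)
    (hspeed : ∀ t ∈ Ioo s (s + τ), ω ^ 2 * u t ^ 2 + u' t ^ 2
      ≤ 2 * (u' t ^ 2 + u t * nonlin lam q (u t) + h t * u t * u' t))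
    (hs : Θ s < Real.pi / 2) :
    ∃ t ∈ Icc s (s + τ), Θ t < Real.pi / 2 - Real.pi := by
  by_contra! hcon
  have hsub : ∀ x ∈ Ioo s (s + τ), x ∈ Ioo 0 T := fun x hx =>
    ⟨hs0.trans_lt hx.1, hx.2.trans_le hsT⟩
  have hnonneg : ∀ x ∈ Ioo s (s + τ), 0 ≤ u x := by
    intro x hx
    obtain ⟨r, hr, h1, -⟩ := hΘ.2 x (Ioo_subset_Icc_self (hsub x hx))
    have h2 := hΘ.lt_pi_div_two hsol.1 hs0 hx.1.le (hsub x hx).2.le hs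
    rw [h1]
    refine mul_nonneg hr.le (Real.cos_nonneg_of_mem_Icc ⟨?_, h2.le⟩)
    linarith [hcon x (Ioo_subset_Icc_self hx)]
  have hpos : ∀ x ∈ Ioo s (s + τ), 0 < u x := by
    intro x hx
    refine lt_of_le_of_ne (hnonneg x hx) fun h0 => ?_
    have hmin : IsLocalMin u x := by
      filter_upwards [isOpen_Ioo.mem_nhds hx] with y hy
      rw [← h0]; exact hnonneg y hy
    have h1 := hmin.hasDerivAt_eq_zero (hsol.hasDerivAt (hsub x hx))
    obtain ⟨r, hr, h2, h3⟩ := hΘ.2 x (Ioo_subset_Icc_self (hsub x hx))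
    have h4 := Real.sin_sq_add_cos_sq (Θ x)
    rw [h1] at h3
    have h5 : Real.cos (Θ x) = 0 := by
      rcases mul_eq_zero.1 (h0.trans h2).symm with h6 | h6
      · exact absurd h6 hr.ne'
      · exact h6
    have h6 : Real.sin (Θ x) = 0 := by
      rcases mul_eq_zero.1 h3.symm with h6 | h6
      · exact absurd h6 hr.ne'
      · exact h6
    rw [h5, h6] at h4
    norm_num at h4
  have hanti : AntitoneOn (fun t => Real.arctan (u' t / (ω * u t)) + ω / 2 * t)
      (Icc (s + τ / 4) (s + 3 * τ / 4)) := by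
    have hsub' : ∀ x ∈ Icc (s + τ / 4) (s + 3 * τ / 4), x ∈ Ioo s (s + τ) := fun x hx =>
      ⟨by linarith [hx.1], by linarith [hx.2]⟩
    have hd : ∀ x ∈ Icc (s + τ / 4) (s + 3 * τ / 4),
        HasDerivAt (fun t => Real.arctan (u' t / (ω * u t)) + ω / 2 * t)
          (-(ω * (u' x ^ 2 + u x * nonlin lam q (u x) + h x * u x * u' x)
            / (ω ^ 2 * u x ^ 2 + u' x ^ 2)) + ω / 2) x := by
      intro x hx
      have hux := hpos x (hsub' x hx)
      have hx' := hsub x (hsub' x hx)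
      have h1 := ((hsol.hasDerivAt_deriv hx').div ((hsol.hasDerivAt hx').const_mul ω)
        (mul_pos hω hux).ne').arctan.add ((hasDerivAt_id x).const_mul (ω / 2))
      refine h1.congr_deriv ?_
      simp only [Pi.div_apply, mul_one]
      congr 1
      have h2 : 0 < ω ^ 2 * u x ^ 2 + u' x ^ 2 := by positivity
      have h3 : 1 + (u' x / (ω * u x)) ^ 2
          = (ω ^ 2 * u x ^ 2 + u' x ^ 2) / (ω ^ 2 * u x ^ 2) := by
        field_simp
      rw [h3]
      field_simp
      ring
    refine antitoneOn_Icc_of_hasDerivAt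
      (fun x hx => (hd x hx).continuousAt.continuousWithinAt)
      (fun x hx => hd x (Ioo_subset_Icc_self hx)) ?_
    intro x hx
    have hx1 := hsub' x (Ioo_subset_Icc_self hx)
    have hux := hpos x hx1
    have h2 : 0 < ω ^ 2 * u x ^ 2 + u' x ^ 2 := by positivity
    have h3 : ω / 2 ≤ ω * (u' x ^ 2 + u x * nonlin lam q (u x) + h x * u x * u' x)
            / (ω ^ 2 * u x ^ 2 + u' x ^ 2) := by
      rw [le_div_iff₀ h2]
      have := mul_le_mul_of_nonneg_left (hspeed x hx1) (half_pos hω).le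
      linarith
    linarith
  have h1 := hanti (left_mem_Icc.2 (by linarith)) (right_mem_Icc.2 (by linarith)) (by linarith)
  simp only at h1
  have h2 := Real.arctan_lt_pi_div_two (u' (s + τ / 4) / (ω * u (s + τ / 4)))
  have h3 := Real.neg_pi_div_two_lt_arctan (u' (s + 3 * τ / 4) / (ω * u (s + 3 * τ / 4)))
  nlinarith [Real.pi_pos]

theorem IsAngleOn.lt_of_speed {τ ω b : ℝ} (hτ : 0 < τ) (hω : 0 < ω)
    (hωτ : 8 * Real.pi ≤ ω * τ) (hbT : b ≤ T) (N : ℕ) :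
    ∀ {u u' u'' Θ : ℝ → ℝ} {s : ℝ}, IsAngleOn T u u' Θ →
      SolOn h lam q (Icc 0 T) (Ioc 0 T) u u' u'' → 0 ≤ s → s + N * τ ≤ b →
      (∀ t ∈ Ioo s b, ω ^ 2 * u t ^ 2 + u' t ^ 2
        ≤ 2 * (u' t ^ 2 + u t * nonlin lam q (u t) + h t * u t * u' t)) →
      Θ s < Real.pi / 2 → Θ T < Real.pi / 2 - N * Real.pi := by
  induction N with
  | zero =>
    intro u u' u'' Θ s hΘ hsol hs0 hsb _ hs
    have := hΘ.lt_pi_div_two hsol.1 hs0 (by norm_num at hsb; linarith) le_rfl hs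
    simpa using this
  | succ N ih =>
    intro u u' u'' Θ s hΘ hsol hs0 hsb hspeed hs
    push_cast at hsb ⊢
    have hNτ : 0 ≤ (N : ℝ) * τ := by positivity
    obtain ⟨t, ht, htΘ⟩ := hΘ.exists_lt_neg_pi_div_two hsol hτ hω hωτ hs0 (by linarith)
      (fun t ht => hspeed t ⟨ht.1, by linarith [ht.2]⟩) hs
    have := ih (s := t) hΘ.neg hsol.neg (hs0.trans ht.1) (by linarith [ht.2]) (fun x hx => by
      have h1 := hspeed x ⟨ht.1.trans_lt hx.1, hx.2⟩
      rw [nonlin_neg]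
      linarith) (by linarith)
    linarith

end Angle

section Growth

variable {h P u u' u'' : ℝ → ℝ} {lam q b T c κ₁ κ₂ δ : ℝ}

theorem exists_speed_of_energy (hlam : 0 < lam) (hq : 1 < q) (ω η₀ : ℝ) :
    ∃ E₀ : ℝ, ∀ x y η : ℝ, |η| ≤ η₀ → E₀ ≤ y ^ 2 / 2 + potential lam q x →
      ω ^ 2 * x ^ 2 + y ^ 2 ≤ 2 * (y ^ 2 + x * nonlin lam q x + η * x * y) := by
  obtain ⟨M, hM0, hM⟩ := exists_le_abs_rpow hq (1 + (ω ^ 2 / 2 + η₀ ^ 2) / lam)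
  refine ⟨lam * (M ^ 2 * M ^ (q - 1)) + 2 * (M ^ 2 * (lam + ω ^ 2 / 2 + η₀ ^ 2)),
    fun x y η hη hE => ?_⟩
  have hx : x * nonlin lam q x = x ^ 2 * (lam * (|x| ^ (q - 1) - 1)) := by rw [nonlin]; ring
  have hη2 : η ^ 2 ≤ η₀ ^ 2 := by
    rw [← sq_abs η]; exact pow_le_pow_left₀ (abs_nonneg _) hη 2
  have hcross : -(y ^ 2 / 4 + x ^ 2 * η₀ ^ 2) ≤ η * x * y := by
    have := mul_le_mul_of_nonneg_left hη2 (sq_nonneg x)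
    nlinarith [sq_nonneg (y / 2 + η * x)]
  have hw0 : 0 ≤ |x| ^ (q - 1) := by positivity
  suffices 0 ≤ y ^ 2 / 4 + x ^ 2 * (lam * (|x| ^ (q - 1) - 1) - ω ^ 2 / 2 - η₀ ^ 2) by
    rw [hx]; linarith
  rcases le_total M |x| with hxM | hxM
  · have h1 := hM x hxM
    have h2 : (ω ^ 2 / 2 + η₀ ^ 2) ≤ lam * (|x| ^ (q - 1) - 1) := by
      rw [← div_le_iff₀' hlam]; linarith
    have h3 : 0 ≤ x ^ 2 * (lam * (|x| ^ (q - 1) - 1) - ω ^ 2 / 2 - η₀ ^ 2) :=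
      mul_nonneg (sq_nonneg x) (by linarith)
    positivity
  · have hx2 : x ^ 2 ≤ M ^ 2 := by
      rw [← sq_abs x]; exact pow_le_pow_left₀ (abs_nonneg x) hxM 2
    have hw : |x| ^ (q - 1) ≤ M ^ (q - 1) :=
      Real.rpow_le_rpow (abs_nonneg x) hxM (by linarith)
    have h1 : x ^ 2 * |x| ^ (q - 1) ≤ M ^ 2 * M ^ (q - 1) :=
      mul_le_mul hx2 hw hw0 (sq_nonneg M)
    have h2 : x ^ 2 * (lam + ω ^ 2 / 2 + η₀ ^ 2) ≤ M ^ 2 * (lam + ω ^ 2 / 2 + η₀ ^ 2) :=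
      mul_le_mul_of_nonneg_right hx2 (by positivity)
    have h3 : potential lam q x ≤ lam * (M ^ 2 * M ^ (q - 1)) := by
      rw [potential_eq hq]
      refine mul_le_mul_of_nonneg_left ?_ hlam.le
      have h4 : |x| ^ (q - 1) / (q + 1) ≤ |x| ^ (q - 1) := div_le_self hw0 (by linarith)
      have h5 := mul_le_mul_of_nonneg_left h4 (sq_nonneg x)
      nlinarith [sq_nonneg x]
    have h6 : 0 ≤ x ^ 2 * (lam * |x| ^ (q - 1)) := by positivity
    nlinarith

theorem SolOn.abs_deriv_le (hs : SolOn h lam q (Icc 0 b) (Ioc 0 b) u u' u'')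
    (hlam : 0 < lam) (hq : 1 < q) (hh : ∀ t ∈ Ioo 0 b, 0 ≤ h t) {B C : ℝ} (hB : 0 ≤ B)
    (hpot : ∀ x : ℝ, x ^ 2 ≤ potential lam q x + B) (hC : 0 ≤ C) (hC2 : 2 * (lam + B) ≤ C ^ 2)
    (hu0 : 1 ≤ u 0) (hu'0 : u' 0 = 0) {t : ℝ} (ht : t ∈ Icc 0 b) :
    |u' t| ≤ C * u 0 ^ ((q + 1) / 2) := by
  have h1 := hs.energy_antitoneOn hq hh (left_mem_Icc.2 (ht.1.trans ht.2)) ht ht.1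
  simp only [hu'0] at h1
  have h2 : potential lam q (u 0) ≤ lam * u 0 ^ (q + 1) := by
    rw [potential, abs_of_pos (by linarith)]
    refine mul_le_mul_of_nonneg_left ?_ hlam.le
    have h3 : u 0 ^ (q + 1) / (q + 1) ≤ u 0 ^ (q + 1) :=
      div_le_self (by positivity) (by linarith)
    nlinarith [sq_nonneg (u 0)]
  have h3 : 1 ≤ u 0 ^ (q + 1) := Real.one_le_rpow hu0 (by linarith)
  have h4 : (u 0 ^ ((q + 1) / 2)) ^ 2 = u 0 ^ (q + 1) := by
    rw [← Real.rpow_natCast, ← Real.rpow_mul (by linarith)]; norm_num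
  have h5 := hpot (u t)
  have h6 : u' t ^ 2 ≤ (C * u 0 ^ ((q + 1) / 2)) ^ 2 := by
    rw [mul_pow, h4]
    have h7 : B ≤ B * u 0 ^ (q + 1) := le_mul_of_one_le_right hB h3
    have h8 := mul_le_mul_of_nonneg_right hC2 (zero_le_one.trans h3)
    nlinarith [sq_nonneg (u t)]
  exact abs_le_of_sq_le_sq h6 (by positivity)

theorem SolOn.half_le (hs : SolOn h lam q (Icc 0 b) (Ioc 0 b) u u' u'') {C : ℝ} (hC : 0 < C)
    (hu0 : 1 ≤ u 0) (hd : ∀ t ∈ Icc 0 b, |u' t| ≤ C * u 0 ^ ((q + 1) / 2)) {t : ℝ}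
    (ht : t ∈ Icc 0 b) (htu : t ≤ u 0 ^ (-((q - 1) / 2)) / (2 * C)) : u 0 / 2 ≤ u t := by
  set D := C * u 0 ^ ((q + 1) / 2) with hD
  have hmono : MonotoneOn (fun t => u t + D * t) (Icc 0 b) := by
    refine monotoneOn_Icc_of_hasDerivAt (f' := fun t => u' t + D)
      (hs.continuousOn.add (by fun_prop)) ?_ ?_
    · intro x hx
      exact ((hs.hasDerivAt hx).add ((hasDerivAt_id x).const_mul D)).congr_deriv (by ring)
    · intro x hx
      linarith [(abs_le.1 (hd x (Ioo_subset_Icc_self hx))).1]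
  have h1 := hmono (left_mem_Icc.2 (ht.1.trans ht.2)) ht ht.1
  simp only [mul_zero, add_zero] at h1
  have hD0 : 0 ≤ D := by positivity
  have h2 : D * t ≤ D * (u 0 ^ (-((q - 1) / 2)) / (2 * C)) := mul_le_mul_of_nonneg_left htu hD0
  have h3 : D * (u 0 ^ (-((q - 1) / 2)) / (2 * C)) = u 0 / 2 := by
    have h4 : u 0 ^ ((q + 1) / 2) * u 0 ^ (-((q - 1) / 2)) = u 0 := by
      rw [← Real.rpow_add (by linarith)]
      ring_nf
      exact Real.rpow_one _
    rw [hD]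
    calc C * u 0 ^ ((q + 1) / 2) * (u 0 ^ (-((q - 1) / 2)) / (2 * C))
        = (u 0 ^ ((q + 1) / 2) * u 0 ^ (-((q - 1) / 2))) / 2 := by field_simp
      _ = u 0 / 2 := by rw [h4]
  linarith

theorem div_rpow_le_exp_primitive (hP : ∀ t ∈ Ioc 0 T, HasDerivAt P (h t) t) (hPT : P T = 0)
    (hκ : ∀ t ∈ Ioc 0 T, t * h t ≤ κ₂) {t : ℝ} (ht : t ∈ Ioc 0 T) :
    (t / T) ^ κ₂ ≤ Real.exp (P t) := by
  have hT : 0 < T := ht.1.trans_le ht.2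
  have hpos : ∀ x ∈ Icc t T, x ∈ Ioc 0 T := fun x hx => ⟨ht.1.trans_le hx.1, hx.2⟩
  have hd : ∀ x ∈ Icc t T, HasDerivAt (fun x => P x - κ₂ * Real.log x) (h x - κ₂ * x⁻¹) x :=
    fun x hx => (hP x (hpos x hx)).sub ((Real.hasDerivAt_log (hpos x hx).1.ne').const_mul κ₂)
  have hanti := antitoneOn_Icc_of_hasDerivAt
    (fun x hx => (hd x hx).continuousAt.continuousWithinAt)
    (fun x hx => hd x (Ioo_subset_Icc_self hx)) (fun x hx => by
      have hx' := hpos x (Ioo_subset_Icc_self hx)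
      have h1 := hκ x hx'
      have h2 : h x ≤ κ₂ / x := by rw [le_div_iff₀ hx'.1]; linarith
      rw [div_eq_mul_inv] at h2
      linarith)
  have h1 := hanti (left_mem_Icc.2 ht.2) (right_mem_Icc.2 ht.2) ht.2
  simp only [hPT] at h1
  rw [Real.rpow_def_of_pos (div_pos ht.1 hT), Real.log_div ht.1.ne' hT.ne']
  exact Real.exp_le_exp.2 (by nlinarith)

theorem pohozaev_bracket_ge (hlam : 0 < lam) (hq : 1 < q) (hκc : κ₂ ≤ 1 + 2 * c)
    (hc : 0 ≤ c) (hδ : c + δ ≤ (κ₁ + 1) / (q + 1)) {τ : ℝ} (h1 : κ₁ ≤ τ) (h2 : τ ≤ κ₂) (x y : ℝ) :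
    lam * (x ^ 2 * (δ * |x| ^ (q - 1) - (κ₂ + 1) / 2))
      ≤ ((1 - τ) / 2 + c) * y ^ 2 + (τ + 1) * potential lam q x - c * x * nonlin lam q x := by
  have hw : 0 ≤ |x| ^ (q - 1) := by positivity
  have h3 : 0 ≤ ((1 - τ) / 2 + c) * y ^ 2 := mul_nonneg (by linarith) (sq_nonneg y)
  have h4 : (τ + 1) * potential lam q x - c * x * nonlin lam q x
      = lam * (x ^ 2 * (((τ + 1) / (q + 1) - c) * |x| ^ (q - 1) - ((τ + 1) / 2 - c))) := by
    rw [potential_eq hq, nonlin]; ring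
  have h5 : (κ₁ + 1) / (q + 1) ≤ (τ + 1) / (q + 1) :=
    div_le_div_of_nonneg_right (by linarith) (by linarith)
  have h6 : δ * |x| ^ (q - 1) ≤ ((τ + 1) / (q + 1) - c) * |x| ^ (q - 1) :=
    mul_le_mul_of_nonneg_right (by linarith) hw
  have h7 : lam * (x ^ 2 * (δ * |x| ^ (q - 1) - (κ₂ + 1) / 2))
      ≤ lam * (x ^ 2 * (((τ + 1) / (q + 1) - c) * |x| ^ (q - 1) - ((τ + 1) / 2 - c))) :=
    mul_le_mul_of_nonneg_left (mul_le_mul_of_nonneg_left (by linarith) (sq_nonneg x)) hlam.le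
  linarith

/-- The Pohozaev functional `e^P (t E + c u u')`, where `P' = h`. -/
noncomputable def pohozaev (lam q c : ℝ) (P u u' : ℝ → ℝ) (t : ℝ) : ℝ :=
  Real.exp (P t) * (t * (u' t ^ 2 / 2 + potential lam q (u t)) + c * (u t * u' t))

theorem SolOn.hasDerivAt_pohozaev (hs : SolOn h lam q (Icc 0 b) (Ioc 0 b) u u' u'')
    (hq : 1 < q) {t : ℝ} (ht : t ∈ Ioo 0 b) (hP : HasDerivAt P (h t) t) :
    HasDerivAt (pohozaev lam q c P u u')
      (Real.exp (P t) * (((1 - t * h t) / 2 + c) * u' t ^ 2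
        + (t * h t + 1) * potential lam q (u t) - c * u t * nonlin lam q (u t))) t := by
  have h1 := hs.hasDerivAt ht
  have h2 := hs.hasDerivAt_deriv ht
  have h3 := ((h2.pow 2).div_const 2).add ((hasDerivAt_potential (lam := lam) hq (u t)).comp t h1)
  have h4 := hP.exp.mul (((hasDerivAt_id t).mul h3).add ((h1.mul h2).const_mul c))
  refine h4.congr_deriv ?_
  simp only [Pi.add_apply, Pi.mul_apply, Pi.pow_apply, Function.comp_apply, id]
  push_cast
  ring

theorem SolOn.le_pohozaev (hs : SolOn h lam q (Icc 0 b) (Ioc 0 b) u u' u'')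
    (hlam : 0 < lam) (hq : 1 < q) (hTb : T < b)
    (hP : ∀ t ∈ Ioc 0 T, HasDerivAt P (h t) t) (hPT : P T = 0)
    (hP0 : ∀ t ∈ Ioc 0 T, P t ≤ 0)
    (hκ₂ : 0 ≤ κ₂) (hκ₁t : ∀ t ∈ Ioc 0 T, κ₁ ≤ t * h t) (hκ₂t : ∀ t ∈ Ioc 0 T, t * h t ≤ κ₂)
    (hκc : κ₂ ≤ 1 + 2 * c) (hc : 0 ≤ c) (hδ : c + δ ≤ (κ₁ + 1) / (q + 1)) (hδ0 : 0 < δ)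
    {B M r t₁ : ℝ} (hB0 : 0 ≤ B)
    (hB : ∀ x : ℝ, -B ≤ lam * (x ^ 2 * (δ * |x| ^ (q - 1) - (κ₂ + 1) / 2)))
    (hM : ∀ x : ℝ, M ≤ |x| → (κ₂ + 1) / δ ≤ |x| ^ (q - 1))
    (hr : 0 < r) (hrM : M ≤ r) (ht₁ : 0 < t₁) (ht₁T : t₁ ≤ T)
    (hur : ∀ t ∈ Icc 0 t₁, r ≤ u t) (hu'0 : u' 0 = 0) :
    lam * δ / 2 * r ^ (q + 1) / T ^ κ₂ * (t₁ ^ (κ₂ + 1) / (κ₂ + 1)) - B * T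
      ≤ T * (u' T ^ 2 / 2 + potential lam q (u T)) + c * (u T * u' T) := by
  have hT : 0 < T := ht₁.trans_le ht₁T
  set J := lam * δ / 2 * r ^ (q + 1) / T ^ κ₂ with hJ
  have hJ0 : 0 ≤ J := by positivity
  have hHd : ∀ t ∈ Ioc 0 T, HasDerivAt (pohozaev lam q c P u u')
      (Real.exp (P t) * (((1 - t * h t) / 2 + c) * u' t ^ 2
        + (t * h t + 1) * potential lam q (u t) - c * u t * nonlin lam q (u t))) t :=
    fun t ht => hs.hasDerivAt_pohozaev hq ⟨ht.1, ht.2.trans_lt hTb⟩ (hP t ht)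
  have hbr : ∀ t ∈ Ioc 0 T, lam * (u t ^ 2 * (δ * |u t| ^ (q - 1) - (κ₂ + 1) / 2))
      ≤ ((1 - t * h t) / 2 + c) * u' t ^ 2
        + (t * h t + 1) * potential lam q (u t) - c * u t * nonlin lam q (u t) := fun t ht =>
    pohozaev_bracket_ge hlam hq hκc hc hδ (hκ₁t t ht) (hκ₂t t ht) (u t) (u' t)
  have hpd : ∀ t : ℝ, 0 < t →
      HasDerivAt (fun t : ℝ => J * (t ^ (κ₂ + 1) / (κ₂ + 1))) (J * t ^ κ₂) t := by
    intro t ht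
    refine (((Real.hasDerivAt_rpow_const (p := κ₂ + 1) (Or.inl ht.ne')).div_const
      (κ₂ + 1)).const_mul J).congr_deriv ?_
    have : κ₂ + 1 ≠ 0 := by linarith
    rw [add_sub_cancel_right]
    field_simp
  have hearly : ∀ s ∈ Ioc 0 t₁, pohozaev lam q c P u u' s - J * (s ^ (κ₂ + 1) / (κ₂ + 1))
      ≤ pohozaev lam q c P u u' t₁ - J * (t₁ ^ (κ₂ + 1) / (κ₂ + 1)) := by
    intro s hs1
    have hin : ∀ x ∈ Icc s t₁, x ∈ Ioc 0 T := fun x hx =>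
      ⟨hs1.1.trans_le hx.1, hx.2.trans ht₁T⟩
    have hd := fun x (hx : x ∈ Icc s t₁) => (hHd x (hin x hx)).sub (hpd x (hin x hx).1)
    refine monotoneOn_Icc_of_hasDerivAt
      (fun x hx => (hd x hx).continuousAt.continuousWithinAt)
      (fun x hx => hd x (Ioo_subset_Icc_self hx)) (fun x hx => ?_)
      (left_mem_Icc.2 hs1.2) (right_mem_Icc.2 hs1.2) hs1.2
    have hx' := hin x (Ioo_subset_Icc_self hx)
    have hru := hur x ⟨hx'.1.le, hx.2.le⟩
    have hau : |u x| = u x := abs_of_pos (hr.trans_le hru)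
    have hw := hM (u x) (by rw [hau]; exact hrM.trans hru)
    have hw' : κ₂ + 1 ≤ δ * |u x| ^ (q - 1) := (div_le_iff₀' hδ0).1 hw
    have h1 : lam * δ / 2 * r ^ (q + 1)
        ≤ lam * (u x ^ 2 * (δ * |u x| ^ (q - 1) - (κ₂ + 1) / 2)) := by
      have h2 : r ^ (q + 1) ≤ |u x| ^ (q + 1) := by
        rw [hau]; exact Real.rpow_le_rpow hr.le hru (by linarith)
      rw [abs_rpow_add_one hq] at h2
      have h3 : u x ^ 2 * (δ / 2 * |u x| ^ (q - 1))
          ≤ u x ^ 2 * (δ * |u x| ^ (q - 1) - (κ₂ + 1) / 2) :=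
        mul_le_mul_of_nonneg_left (by linarith) (sq_nonneg _)
      have h4 := mul_le_mul_of_nonneg_left h3 hlam.le
      have h5 := mul_le_mul_of_nonneg_left h2 (show 0 ≤ lam * δ / 2 by positivity)
      linarith
    have h2 := div_rpow_le_exp_primitive hP hPT hκ₂t hx'
    have h3 := h1.trans (hbr x hx')
    have h4 : 0 ≤ lam * δ / 2 * r ^ (q + 1) := by positivity
    have h5 := mul_le_mul h2 h3 h4 (Real.exp_pos _).le
    have h6 : (x / T) ^ κ₂ * (lam * δ / 2 * r ^ (q + 1)) = J * x ^ κ₂ := by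
      rw [Real.div_rpow hx'.1.le hT.le, hJ]; ring
    linarith
  have hH1 : J * (t₁ ^ (κ₂ + 1) / (κ₂ + 1)) ≤ pohozaev lam q c P u u' t₁ := by
    have hpc : Continuous (potential lam q) :=
      continuous_iff_continuousAt.2 fun x => (hasDerivAt_potential hq x).continuousAt
    have hsubb : Ioo 0 t₁ ⊆ Icc 0 b := fun x hx => ⟨hx.1.le, (hx.2.trans_le ht₁T).le.trans hTb.le⟩
    have h0b : (0 : ℝ) ∈ Icc 0 b := ⟨le_rfl, hT.le.trans hTb.le⟩
    have hcont : ContinuousOn (fun s => -|s * (u' s ^ 2 / 2 + potential lam q (u s))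
        + c * (u s * u' s)| - J * (s ^ (κ₂ + 1) / (κ₂ + 1))) (Icc 0 b) := by
      have h1 := hs.continuousOn
      have h2 := hs.2.1
      have h3 := hpc.comp_continuousOn h1
      have h4 : ContinuousOn (fun s : ℝ => s ^ (κ₂ + 1)) (Icc 0 b) :=
        continuousOn_id.rpow_const (fun _ _ => Or.inr (by linarith))
      exact ((((continuousOn_id.mul (((h2.pow 2).div_const 2).add h3)).add
        (continuousOn_const.mul (h1.mul h2))).abs).neg).sub
        (continuousOn_const.mul (h4.div_const _))
    have htend := (hcont 0 h0b).mono_left (nhdsWithin_mono 0 hsubb)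
    have hv : κ₂ + 1 ≠ 0 := by linarith
    simp only [hu'0, Real.zero_rpow hv, zero_mul, mul_zero, add_zero, abs_zero, neg_zero,
      zero_div, sub_zero] at htend
    have : (nhdsWithin (0 : ℝ) (Ioo 0 t₁)).NeBot := by
      rw [nhdsWithin_Ioo_eq_nhdsGT ht₁]; infer_instance
    have hle := le_of_tendsto (b := pohozaev lam q c P u u' t₁
      - J * (t₁ ^ (κ₂ + 1) / (κ₂ + 1))) htend (by
        filter_upwards [self_mem_nhdsWithin] with s hs1
        refine le_trans ?_ (hearly s ⟨hs1.1, hs1.2.le⟩)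
        refine sub_le_sub_right ?_ _
        have he : Real.exp (P s) ≤ 1 :=
          Real.exp_le_one_iff.2 (hP0 s ⟨hs1.1, hs1.2.le.trans ht₁T⟩)
        rw [pohozaev]
        refine le_trans (neg_le_neg ?_) (neg_abs_le _)
        rw [abs_mul, abs_of_pos (Real.exp_pos _)]
        exact mul_le_of_le_one_left (abs_nonneg _) he)
    linarith
  have hlate : pohozaev lam q c P u u' t₁ + B * t₁ ≤ pohozaev lam q c P u u' T + B * T := by
    have hin : ∀ x ∈ Icc t₁ T, x ∈ Ioc 0 T := fun x hx => ⟨ht₁.trans_le hx.1, hx.2⟩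
    have hd := fun x (hx : x ∈ Icc t₁ T) =>
      (hHd x (hin x hx)).add ((hasDerivAt_id x).const_mul B)
    refine monotoneOn_Icc_of_hasDerivAt
      (fun x hx => (hd x hx).continuousAt.continuousWithinAt)
      (fun x hx => hd x (Ioo_subset_Icc_self hx)) (fun x hx => ?_)
      (left_mem_Icc.2 ht₁T) (right_mem_Icc.2 ht₁T) ht₁T
    have hx' := hin x (Ioo_subset_Icc_self hx)
    have h1 := (hB (u x)).trans (hbr x hx')
    have h2 := mul_le_mul_of_nonneg_left h1 (Real.exp_pos (P x)).le
    have h3 := mul_le_mul_of_nonneg_right (Real.exp_le_one_iff.2 (hP0 x hx')) hB0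
    linarith
  have hfin : pohozaev lam q c P u u' T
      = T * (u' T ^ 2 / 2 + potential lam q (u T)) + c * (u T * u' T) := by
    rw [pohozaev, hPT, Real.exp_zero, one_mul]
  have hBt : 0 ≤ B * t₁ := by positivity
  linarith

end Growth

section Family

variable {h P : ℝ → ℝ} {lam q b T c κ₁ κ₂ δ : ℝ}

theorem eventually_le_energy (hlam : 0 < lam) (hq : 1 < q) (hT : 0 < T) (hTb : T < b)
    (hh : ∀ t ∈ Ioo 0 b, 0 ≤ h t)
    (hP : ∀ t ∈ Ioc 0 T, HasDerivAt P (h t) t) (hPT : P T = 0)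
    (hP0 : ∀ t ∈ Ioc 0 T, P t ≤ 0)
    (hκ₂ : 0 ≤ κ₂) (hκ₁t : ∀ t ∈ Ioc 0 T, κ₁ ≤ t * h t) (hκ₂t : ∀ t ∈ Ioc 0 T, t * h t ≤ κ₂)
    (hκc : κ₂ ≤ 1 + 2 * c) (hc : 0 ≤ c) (hδ : c + δ ≤ (κ₁ + 1) / (q + 1)) (hδ0 : 0 < δ)
    (hsub : (q - 1) * (κ₂ + 1) < 2 * (q + 1)) (E₀ : ℝ) :
    ∀ᶠ α in atTop, ∀ u u' u'' : ℝ → ℝ, SolOn h lam q (Icc 0 b) (Ioc 0 b) u u' u'' →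
      u 0 = α → u' 0 = 0 → E₀ ≤ u' T ^ 2 / 2 + potential lam q (u T) := by
  obtain ⟨B₁, hB₁0, hB₁⟩ := exists_sq_le_potential_add hlam hq
  obtain ⟨B₂, hB₂0, hB₂⟩ := exists_neg_le_sq_mul hq hδ0 ((κ₂ + 1) / 2)
  obtain ⟨M, hM0, hM⟩ := exists_le_abs_rpow hq ((κ₂ + 1) / δ)
  set C := Real.sqrt (2 * (lam + B₁)) with hCdef
  have hC : 0 < C := Real.sqrt_pos.2 (by positivity)
  have hC2 : 2 * (lam + B₁) ≤ C ^ 2 := by rw [hCdef, Real.sq_sqrt (by positivity)]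
  set γ := q + 1 - (q - 1) / 2 * (κ₂ + 1) with hγ
  have hγ0 : 0 < γ := by rw [hγ]; linarith
  set A := lam * δ / 2 * (1 / 2) ^ (q + 1) / T ^ κ₂ * ((1 / (2 * C)) ^ (κ₂ + 1) / (κ₂ + 1))
    with hA
  have hA0 : 0 < A := by positivity
  have hbig := ((tendsto_rpow_atTop hγ0).const_mul_atTop hA0).eventually_ge_atTop
    ((T + c) * E₀ + c * B₁ + lam * B₂ * T)
  have hsmall : ∀ᶠ α : ℝ in atTop, α ^ (-((q - 1) / 2)) / (2 * C) ≤ T := by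
    have h1 := ((tendsto_rpow_neg_atTop (y := (q - 1) / 2) (by linarith)).div_const
      (2 * C))
    rw [zero_div] at h1
    exact (h1.eventually_lt_const hT).mono fun _ h => h.le
  filter_upwards [hbig, hsmall, eventually_ge_atTop 1, eventually_ge_atTop (2 * M)]
    with α h1 h2 h3 h4 u u' u'' hs hu0 hu'0
  have hα : 0 < α := by linarith
  have hd := fun t (ht : t ∈ Icc 0 b) =>
    hs.abs_deriv_le hlam hq hh hB₁0 hB₁ hC.le hC2 (by rw [hu0]; exact h3) hu'0 ht
  have ht₁ : 0 < α ^ (-((q - 1) / 2)) / (2 * C) := by positivity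
  have hur : ∀ t ∈ Icc 0 (α ^ (-((q - 1) / 2)) / (2 * C)), α / 2 ≤ u t := by
    intro t ht
    have := hs.half_le hC (by rw [hu0]; exact h3) hd
      (t := t) ⟨ht.1, (ht.2.trans h2).trans hTb.le⟩ (by rw [hu0]; exact ht.2)
    rwa [hu0] at this
  have h5 := hs.le_pohozaev hlam hq hTb hP hPT hP0 hκ₂ hκ₁t hκ₂t hκc hc hδ hδ0
    (B := lam * B₂) (by positivity) (fun x => by
      have := mul_le_mul_of_nonneg_left (hB₂ x) hlam.le
      linarith) hM (half_pos hα) (by linarith) ht₁ h2 hur hu'0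
  have h6 : lam * δ / 2 * (α / 2) ^ (q + 1) / T ^ κ₂
      * ((α ^ (-((q - 1) / 2)) / (2 * C)) ^ (κ₂ + 1) / (κ₂ + 1)) = A * α ^ γ := by
    have e1 : (α / 2) ^ (q + 1) = α ^ (q + 1) * (1 / 2) ^ (q + 1) := by
      rw [← Real.mul_rpow hα.le (by norm_num)]; ring_nf
    have e2 : (α ^ (-((q - 1) / 2)) / (2 * C)) ^ (κ₂ + 1)
        = α ^ (-((q - 1) / 2) * (κ₂ + 1)) * (1 / (2 * C)) ^ (κ₂ + 1) := by
      rw [Real.rpow_mul hα.le, ← Real.mul_rpow (by positivity) (by positivity)]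
      ring_nf
    have e3 : α ^ γ = α ^ (q + 1) * α ^ (-((q - 1) / 2) * (κ₂ + 1)) := by
      rw [← Real.rpow_add hα, hγ]; ring_nf
    rw [e1, e2, e3, hA]
    ring
  rw [h6] at h5
  have h7 : u T * u' T ≤ (u' T ^ 2 / 2 + potential lam q (u T)) + B₁ := by
    have := hB₁ (u T)
    nlinarith [sq_nonneg (u T - u' T), sq_nonneg (u T)]
  have h8 := mul_le_mul_of_nonneg_left h7 hc
  have h9 : (T + c) * E₀ ≤ (T + c) * (u' T ^ 2 / 2 + potential lam q (u T)) := by linarith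
  exact le_of_mul_le_mul_left h9 (by linarith)

theorem exists_lipschitz_in_initial_value {U U' U'' : ℝ → ℝ → ℝ} (hlam : 0 < lam) (hq : 1 < q)
    (hh : ∀ t ∈ Ioo 0 b, 0 ≤ h t)
    (hU : ∀ α : ℝ, SolOn h lam q (Icc 0 b) (Ioc 0 b) (U α) (U' α) (U'' α) ∧
      U α 0 = α ∧ U' α 0 = 0) (α₁ α₂ : ℝ) :
    ∃ K : ℝ, 0 ≤ K ∧ ∀ α ∈ Icc α₁ α₂, ∀ β ∈ Icc α₁ α₂, ∀ t ∈ Icc 0 b,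
      |U α t - U β t| ≤ K * |α - β| ∧ |U' α t - U' β t| ≤ K * |α - β| := by
  obtain ⟨B, hB0, hB⟩ := exists_sq_le_potential_add hlam hq
  have hpc : Continuous (potential lam q) :=
    continuous_iff_continuousAt.2 fun x => (hasDerivAt_potential hq x).continuousAt
  obtain ⟨F, hF⟩ := (isCompact_Icc (a := α₁) (b := α₂)).exists_bound_of_continuousOn
    hpc.continuousOn
  have hbd : ∀ α ∈ Icc α₁ α₂, ∀ t ∈ Icc 0 b, |U α t| ≤ Real.sqrt (F + B) := by
    intro α hα t ht
    obtain ⟨hs, h0, h0'⟩ := hU α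
    have h1 := hs.energy_antitoneOn hq hh (left_mem_Icc.2 (ht.1.trans ht.2)) ht ht.1
    simp only [h0, h0'] at h1
    have h2 := (le_abs_self _).trans (hF α hα)
    have h3 := hB (U α t)
    exact Real.abs_le_sqrt (by nlinarith [sq_nonneg (U' α t)])
  obtain ⟨L, hL0, hL⟩ := exists_nonlin_lipschitz hlam hq (Real.sqrt (F + B))
  refine ⟨Real.sqrt (Real.exp ((1 + L) * b)), Real.sqrt_nonneg _, fun α hα β hβ t ht => ?_⟩
  obtain ⟨hs, h0, h0'⟩ := hU α
  obtain ⟨hs', h1, h1'⟩ := hU β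
  have h2 := hs.dist_sq_le hs' hh hL0 hL (hbd α hα) (hbd β hβ) ht
  rw [h0, h0', h1, h1'] at h2
  have h3 : Real.sqrt (Real.exp ((1 + L) * b)) * |α - β|
      = Real.sqrt (Real.exp ((1 + L) * b) * (α - β) ^ 2) := by
    rw [Real.sqrt_mul (Real.exp_pos _).le, Real.sqrt_sq_eq_abs]
  rw [h3]
  constructor <;> refine Real.abs_le_sqrt ?_
  · nlinarith [sq_nonneg (U' α t - U' β t)]
  · nlinarith [sq_nonneg (U α t - U β t)]

theorem continuous_projIcc_family {U : ℝ → ℝ → ℝ} {α₁ α₂ K : ℝ} (hα : α₁ ≤ α₂) (hb : 0 ≤ b)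
    (hK : 0 ≤ K) (hcont : ∀ α, ContinuousOn (U α) (Icc 0 b))
    (hlip : ∀ α ∈ Icc α₁ α₂, ∀ β ∈ Icc α₁ α₂, ∀ t ∈ Icc 0 b, |U α t - U β t| ≤ K * |α - β|) :
    Continuous fun p : ℝ × ℝ => U (projIcc α₁ α₂ hα p.1) (projIcc 0 b hb p.2) := by
  refine continuous_prod_of_continuous_lipschitzWith _ K.toNNReal (fun s => ?_) (fun x => ?_)
  · exact (hcont (projIcc α₁ α₂ hα s)).comp_continuous (continuous_subtype_val.comp continuous_projIcc)
      (fun x => (projIcc 0 b hb x).2)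
  · refine LipschitzWith.of_dist_le_mul fun s s' => ?_
    rw [Real.coe_toNNReal K hK, Real.dist_eq]
    refine (hlip _ (projIcc α₁ α₂ hα s).2 _ (projIcc α₁ α₂ hα s').2 _
      (projIcc 0 b hb x).2).trans (mul_le_mul_of_nonneg_left ?_ hK)
    exact abs_projIcc_sub_projIcc hα

end Family

theorem exists_subcritical_constants {q k : ℝ} (hq : 1 < q) (hk : 1 ≤ k)
    (hsub : q * (k - 1) < k + 3) :
    ∃ ε c δ : ℝ, 0 < ε ∧ 0 ≤ c ∧ 0 < δ ∧ k + ε ≤ 1 + 2 * c ∧ c + δ ≤ (k - ε + 1) / (q + 1) ∧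
      (q - 1) * (k + ε + 1) < 2 * (q + 1) := by
  have hg : 0 < k + 3 - q * (k - 1) := by linarith
  set ε := (k + 3 - q * (k - 1)) / (q + 4) with hε
  have hε0 : 0 < ε := div_pos hg (by linarith)
  have hεg : ε * (q + 4) = k + 3 - q * (k - 1) := by
    rw [hε]; field_simp
  have hlt : (k - 1 + ε) / 2 < (k - ε + 1) / (q + 1) := by
    rw [div_lt_div_iff₀ (by norm_num) (by linarith)]
    nlinarith
  exact ⟨ε, (k - 1 + ε) / 2, (k - ε + 1) / (q + 1) - (k - 1 + ε) / 2, hε0, by linarith,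
    by linarith, by linarith, by linarith, by nlinarith⟩

theorem cos_eq_one_of_polar {r θ : ℝ} (hr : 0 < r) (hcos : 0 < r * Real.cos θ)
    (hsin : r * Real.sin θ = 0) : Real.cos θ = 1 := by
  have h1 : Real.sin θ = 0 := (mul_eq_zero.1 hsin).resolve_left hr.ne'
  have h2 : 0 < Real.cos θ := pos_of_mul_pos_right hcos hr.le
  have h3 := Real.sin_sq_add_cos_sq θ
  rw [h1] at h3
  nlinarith

theorem cos_sub_eq_one_of_polar {r ρ θ φ : ℝ} (hr : 0 < r) (hρ : 0 ≤ ρ)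
    (hcos : r * Real.cos θ = ρ * Real.cos φ) (hsin : r * Real.sin θ = ρ * Real.sin φ) :
    Real.cos (θ - φ) = 1 := by
  have h1 := Real.sin_sq_add_cos_sq θ
  have h2 := Real.sin_sq_add_cos_sq φ
  have h3 : r ^ 2 = ρ ^ 2 := by
    calc r ^ 2 = (r * Real.cos θ) ^ 2 + (r * Real.sin θ) ^ 2 := by linear_combination -r ^ 2 * h1
      _ = ρ ^ 2 := by rw [hcos, hsin]; linear_combination ρ ^ 2 * h2
  have h4 : r = ρ := (pow_left_inj₀ hr.le hρ two_ne_zero).1 h3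
  rw [← h4] at hcos hsin
  rw [Real.cos_sub, mul_left_cancel₀ hr.ne' hcos, mul_left_cancel₀ hr.ne' hsin]
  linarith

/-- The angle function at the endpoint `b` is realised by a continuous polar angle, starting at
`0`, of the curve `(u_α, u_α')` on `[0, b]`. -/
theorem exists_isAngleOn_eq {h : ℝ → ℝ} {lam q b d : ℝ} {U U' U'' : ℝ → ℝ → ℝ} {a : ℝ → ℝ}
    (hlam : 0 < lam) (hq : 1 < q) (hcont : ContinuousOn h (Ioo 0 d)) (hb : b ∈ Ioo 0 d)
    (hh : ∀ t ∈ Ioo 0 b, 0 ≤ h t)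
    (hU : ∀ α : ℝ, SolOn h lam q (Icc 0 b) (Ioc 0 b) (U α) (U' α) (U'' α) ∧
      U α 0 = α ∧ U' α 0 = 0)
    (hone : ∀ t ∈ Icc 0 b, U 1 t = 1 ∧ U' 1 t = 0)
    (haCont : ContinuousOn a (Ioi 0)) (ha1 : a 1 = 0)
    (haAngle : ∀ α : ℝ, 0 < α →
      U α b = enorm2 (U α b, U' α b) * Real.cos (a α) ∧
      U' α b = enorm2 (U α b, U' α b) * Real.sin (a α)) {α : ℝ} (hα : 1 ≤ α) :
    ∃ Θ : ℝ → ℝ, IsAngleOn b (U α) (U' α) Θ ∧ Θ 0 = 0 ∧ Θ b = a α := by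
  have hb0 : 0 ≤ b := hb.1.le
  obtain ⟨K, hK0, hK⟩ := exists_lipschitz_in_initial_value hlam hq hh hU 1 α
  have hc : Continuous fun p : ℝ × ℝ => U (projIcc 1 α hα p.1) (projIcc 0 b hb0 p.2) :=
    continuous_projIcc_family hα hb0 hK0 (fun α => (hU α).1.continuousOn)
      (fun α hα β hβ t ht => (hK α hα β hβ t ht).1)
  have hc' : Continuous fun p : ℝ × ℝ => U' (projIcc 1 α hα p.1) (projIcc 0 b hb0 p.2) :=
    continuous_projIcc_family hα hb0 hK0 (fun α => (hU α).1.2.1)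
      (fun α hα β hβ t ht => (hK α hα β hβ t ht).2)
  let z : ℝ × ℝ → ℂ := fun p => (U (projIcc 1 α hα p.1) (projIcc 0 b hb0 p.2) : ℂ)
    + (U' (projIcc 1 α hα p.1) (projIcc 0 b hb0 p.2) : ℂ) * Complex.I
  have hz : Continuous z := (Complex.continuous_ofReal.comp hc).add
    ((Complex.continuous_ofReal.comp hc').mul continuous_const)
  have hzre : ∀ s ∈ Icc 1 α, ∀ t ∈ Icc 0 b, (z (s, t)).re = U s t := by
    intro s hs t ht
    simp [z, projIcc_of_mem hα hs, projIcc_of_mem hb0 ht]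
  have hzim : ∀ s ∈ Icc 1 α, ∀ t ∈ Icc 0 b, (z (s, t)).im = U' s t := by
    intro s hs t ht
    simp [z, projIcc_of_mem hα hs, projIcc_of_mem hb0 ht]
  have hzne : ∀ p, z p ≠ 0 := by
    intro p hp
    obtain ⟨hs, h0, -⟩ := hU (projIcc 1 α hα p.1)
    refine hs.eq_zero_or_deriv_ne_zero hlam hq hcont hb hh ?_ (projIcc 0 b hb0 p.2).2 ⟨?_, ?_⟩
    · rw [h0]
      exact (zero_lt_one.trans_le (projIcc 1 α hα p.1).2.1).ne'
    · simpa [z] using congrArg Complex.re hp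
    · simpa [z] using congrArg Complex.im hp
  have h1α : (1 : ℝ) ∈ Icc 1 α := left_mem_Icc.2 hα
  have h0b : (0 : ℝ) ∈ Icc 0 b := left_mem_Icc.2 hb0
  have hbb : b ∈ Icc 0 b := right_mem_Icc.2 hb0
  have hz1 : z (1, 0) = 1 := by
    apply Complex.ext
    · rw [hzre 1 h1α 0 h0b, (hone 0 h0b).1, Complex.one_re]
    · rw [hzim 1 h1α 0 h0b, (hone 0 h0b).2, Complex.one_im]
  obtain ⟨g, hgc, hg0, hg⟩ := exists_continuous_exp_lift hz hzne hz1
  have hpolar : ∀ s ∈ Icc 1 α, ∀ t ∈ Icc 0 b,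
      U s t = Real.exp (g (s, t)).re * Real.cos (g (s, t)).im ∧
      U' s t = Real.exp (g (s, t)).re * Real.sin (g (s, t)).im := by
    intro s hs t ht
    rw [← hzre s hs t ht, ← hzim s hs t ht, ← hg, Complex.exp_re, Complex.exp_im]
    exact ⟨rfl, rfl⟩
  have himc : Continuous fun p => (g p).im := Complex.continuous_im.comp hgc
  have hg0' : (g (1, 0)).im = 0 := by rw [hg0]; rfl
  have hstart : ∀ s ∈ Icc 1 α, (g (s, 0)).im = 0 := by
    intro s hs
    refine eq_zero_of_cos_eq_one (f := fun s => (g (s, 0)).im) (by fun_prop)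
      (fun x hx => ?_) hg0' hs
    obtain ⟨h1, h2⟩ := hpolar x hx 0 h0b
    rw [(hU x).2.1] at h1
    rw [(hU x).2.2] at h2
    exact cos_eq_one_of_polar (Real.exp_pos _)
      (by rw [← h1]; exact zero_lt_one.trans_le hx.1) h2.symm
  have hunit : ∀ t ∈ Icc 0 b, (g (1, t)).im = 0 := by
    intro t ht
    refine eq_zero_of_cos_eq_one (f := fun t => (g (1, t)).im) (by fun_prop)
      (fun x hx => ?_) hg0' ht
    obtain ⟨h1, h2⟩ := hpolar 1 h1α x hx
    rw [(hone x hx).1] at h1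
    rw [(hone x hx).2] at h2
    exact cos_eq_one_of_polar (Real.exp_pos _) (by rw [← h1]; exact one_pos) h2.symm
  have hend : (g (α, b)).im - a α = 0 := by
    refine eq_zero_of_cos_eq_one (f := fun s => (g (s, b)).im - a s) (a := 1) (b := α) ?_
      (fun x hx => ?_) (by simp only [hunit b hbb, ha1, sub_zero]) (right_mem_Icc.2 hα)
    · exact (show Continuous fun s => (g (s, b)).im by fun_prop).continuousOn.sub
        (haCont.mono fun x hx => zero_lt_one.trans_le hx.1)
    · obtain ⟨h1, h2⟩ := hpolar x hx b hbb
      obtain ⟨h3, h4⟩ := haAngle x (zero_lt_one.trans_le hx.1)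
      exact cos_sub_eq_one_of_polar (Real.exp_pos _) (Real.sqrt_nonneg _)
        (h1.symm.trans h3) (h2.symm.trans h4)
  refine ⟨fun t => (g (α, t)).im, ⟨by fun_prop, fun t ht => ?_⟩,
    hstart α (right_mem_Icc.2 hα), sub_eq_zero.1 hend⟩
  exact ⟨_, Real.exp_pos _, hpolar α (right_mem_Icc.2 hα) t ht⟩

theorem stmt_9
    (d lam : ℝ) (hd : 0 < d) (hlam : 0 < lam)
    (n m₁ m₂ : ℤ) (hn : 3 ≤ n)
    (hm₁0 : 0 ≤ m₁) (hm₁n : m₁ ≤ n - 2) (hm₂0 : 0 ≤ m₂) (hm₂n : m₂ ≤ n - 2)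
    (h : ℝ → ℝ) (hC1 : ContDiffOn ℝ 1 h (Set.Ioo 0 d))
    (hder : ∀ t ∈ Set.Ioo 0 d, deriv h t < 0)
    (hlim0 : Filter.Tendsto (fun t => t * h t) (nhdsWithin 0 (Set.Ioi 0))
      (nhds ((n : ℝ) - (m₁ : ℝ) - 1)))
    (hlimd : Filter.Tendsto (fun t => (t - d) * h t) (nhdsWithin d (Set.Iio d))
      (nhds ((n : ℝ) - (m₂ : ℝ) - 1)))
    (q : ℝ) (hq1 : 1 < q)
    (hqsub : min m₁ m₂ < n - 2 →
      q < ((n : ℝ) - (min m₁ m₂ : ℝ) + 2) / ((n : ℝ) - (min m₁ m₂ : ℝ) - 2))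
    (t₀ : ℝ) (ht₀ : t₀ ∈ Set.Ioo 0 d)
    (hpos : ∀ t ∈ Set.Ioo 0 t₀, 0 < h t) (hneg : ∀ t ∈ Set.Ioo t₀ d, h t < 0)
    (U U' U'' : ℝ → ℝ → ℝ)
    (hU : ∀ α : ℝ, SolOn h lam q (Set.Icc 0 t₀) (Set.Ioc 0 t₀) (U α) (U' α) (U'' α) ∧
      U α 0 = α ∧ U' α 0 = 0)
    (hUuniq : ∀ α : ℝ, ∀ u u' u'' : ℝ → ℝ,
      SolOn h lam q (Set.Icc 0 t₀) (Set.Ioc 0 t₀) u u' u'' → u 0 = α → u' 0 = 0 →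
      ∀ t ∈ Set.Icc 0 t₀, u t = U α t ∧ u' t = U' α t)
    (a : ℝ → ℝ) (haCont : ContinuousOn a (Set.Ioi 0)) (ha1 : a 1 = 0)
    (haAngle : ∀ α : ℝ, 0 < α →
      U α t₀ = enorm2 (U α t₀, U' α t₀) * Real.cos (a α) ∧
      U' α t₀ = enorm2 (U α t₀, U' α t₀) * Real.sin (a α))
    :
    ∀ K : ℝ, 0 < K → ∃ α₀ : ℝ, 0 < α₀ ∧ ∀ α : ℝ, α₀ ≤ α → a α < -K := by
  intro K hK
  have hcont : ContinuousOn h (Ioo 0 d) := hC1.continuousOn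
  have hh : ∀ t ∈ Ioo 0 t₀, 0 ≤ h t := fun t ht => (hpos t ht).le
  set k : ℝ := (n : ℝ) - m₁ - 1 with hk
  have hk1 : 1 ≤ k := by
    have : (m₁ : ℝ) ≤ n - 2 := by exact_mod_cast hm₁n
    linarith
  have hsub : q * (k - 1) < k + 3 := by
    rcases hm₁n.lt_or_eq with hlt | heq
    · have h1 := hqsub ((min_le_left _ _).trans_lt hlt)
      set m : ℤ := min m₁ m₂ with hm
      have h2 : (m : ℝ) ≤ m₁ := by exact_mod_cast min_le_left m₁ m₂
      have h3 : (m₁ : ℝ) < n - 2 := by exact_mod_cast hlt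
      rw [← Int.cast_min, ← hm] at h1
      rw [lt_div_iff₀ (by linarith)] at h1
      nlinarith
    · have h3 : (m₁ : ℝ) = n - 2 := by exact_mod_cast heq
      have : k = 1 := by rw [hk, h3]; ring
      rw [this]; norm_num
  obtain ⟨ε, c, δ, hε, hc, hδ0, hκc, hδ, hsub'⟩ := exists_subcritical_constants hq1 hk1 hsub
  obtain ⟨T, hT0, hTt₀, hTε⟩ : ∃ T : ℝ, 0 < T ∧ T < t₀ ∧
      ∀ t ∈ Ioc 0 T, k - ε ≤ t * h t ∧ t * h t ≤ k + ε := by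
    have h1 : ∀ᶠ t in nhdsWithin (0 : ℝ) (Ioi 0), t * h t ∈ Ioo (k - ε) (k + ε) :=
      hlim0 (Ioo_mem_nhds (by linarith) (by linarith))
    obtain ⟨S, hS0, hS⟩ := mem_nhdsGT_iff_exists_Ioo_subset.1 h1
    have hS0 : 0 < S := hS0
    refine ⟨min S t₀ / 2, half_pos (lt_min hS0 ht₀.1), ?_, fun t ht => ?_⟩
    · linarith [min_le_right S t₀, ht₀.1]
    · have h2 := hS (show t ∈ Ioo 0 S from
        ⟨ht.1, ht.2.trans_lt (by linarith [min_le_left S t₀])⟩)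
      exact ⟨h2.1.le, h2.2.le⟩
  have hTd : T ∈ Ioo 0 d := ⟨hT0, hTt₀.trans ht₀.2⟩
  obtain ⟨P, hPT, hP⟩ := exists_primitive hcont hTd
  have hP' : ∀ t ∈ Ioc 0 T, HasDerivAt P (h t) t := fun t ht =>
    hP t ⟨ht.1, ht.2.trans_lt hTd.2⟩
  have hP0 : ∀ t ∈ Ioc 0 T, P t ≤ 0 := by
    intro t ht
    have hin : ∀ x ∈ Icc t T, x ∈ Ioc 0 T := fun x hx => ⟨ht.1.trans_le hx.1, hx.2⟩
    rw [← hPT]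
    exact monotoneOn_Icc_of_hasDerivAt
      (fun x hx => (hP' x (hin x hx)).continuousAt.continuousWithinAt)
      (fun x hx => hP' x (hin x (Ioo_subset_Icc_self hx)))
      (fun x hx => hh x ⟨ht.1.trans hx.1, hx.2.trans hTt₀⟩)
      (left_mem_Icc.2 ht.2) (right_mem_Icc.2 ht.2) ht.2
  obtain ⟨N, hN⟩ := exists_nat_ge (K + 1)
  have hN0 : (0 : ℝ) < N := by linarith
  set τ : ℝ := T / 2 / N with hτ
  have hτ0 : 0 < τ := by positivity
  set ω : ℝ := 8 * Real.pi / τ with hω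
  have hω0 : 0 < ω := by positivity
  have hωτ : 8 * Real.pi ≤ ω * τ := by rw [hω, div_mul_cancel₀ _ hτ0.ne']
  obtain ⟨E₀, hE₀⟩ := exists_speed_of_energy hlam hq1 ω (2 * (k + ε) / T)
  have hev := eventually_le_energy hlam hq1 hT0 hTt₀ hh hP' hPT hP0 (by linarith)
    (fun t ht => (hTε t ht).1) (fun t ht => (hTε t ht).2) hκc hc hδ hδ0 hsub' E₀
  obtain ⟨α₀, hα₀⟩ := eventually_atTop.1 hev
  refine ⟨max α₀ 1, by positivity, fun α hα => ?_⟩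
  have hα1 : 1 ≤ α := (le_max_right _ _).trans hα
  obtain ⟨hs, hu0, hu'0⟩ := hU α
  have hET := hα₀ α ((le_max_left _ _).trans hα) _ _ _ hs hu0 hu'0
  have hone : ∀ t ∈ Icc 0 t₀, U 1 t = 1 ∧ U' 1 t = 0 := by
    intro t ht
    have h1 : SolOn h lam q (Icc 0 t₀) (Ioc 0 t₀) (fun _ => 1) (fun _ => 0) (fun _ => 0) :=
      ⟨fun t _ => hasDerivWithinAt_const .., continuousOn_const,
        fun t _ => hasDerivWithinAt_const .., continuousOn_const, fun t _ => by simp⟩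
    have h2 := hUuniq 1 _ _ _ h1 rfl rfl t ht
    exact ⟨h2.1.symm, h2.2.symm⟩
  obtain ⟨Θ, hΘ, hΘ0, hΘb⟩ := exists_isAngleOn_eq hlam hq1 hcont ht₀ hh hU hone haCont ha1
    haAngle hα1
  have hpi := Real.pi_pos
  have hΘT : Θ (T / 2) < Real.pi / 2 :=
    hΘ.lt_pi_div_two hs.1 le_rfl (half_pos hT0).le (by linarith) (by rw [hΘ0]; linarith)
  have hspeed : ∀ t ∈ Ioo (T / 2) T, ω ^ 2 * U α t ^ 2 + U' α t ^ 2
      ≤ 2 * (U' α t ^ 2 + U α t * nonlin lam q (U α t) + h t * U α t * U' α t) := by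
    intro t ht
    have ht0 : 0 < t := (half_pos hT0).trans ht.1
    refine hE₀ _ _ _ ?_ (hET.trans (hs.energy_antitoneOn hq1 hh
      ⟨ht0.le, (ht.2.trans hTt₀).le⟩ ⟨hT0.le, hTt₀.le⟩ ht.2.le))
    have h1 := hh t ⟨ht0, ht.2.trans hTt₀⟩
    rw [abs_of_nonneg h1, le_div_iff₀ hT0]
    have h2 := (hTε t ⟨ht0, ht.2.le⟩).2
    nlinarith [ht.1]
  have hNτ : (N : ℝ) * τ = T / 2 := by rw [hτ]; field_simp
  have hfinal := IsAngleOn.lt_of_speed hτ0 hω0 hωτ hTt₀.le N hΘ hs (half_pos hT0).le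
    (by rw [hNτ]; linarith) hspeed hΘT
  rw [hΘb] at hfinal
  have h3 : (K + 1) * Real.pi ≤ N * Real.pi := mul_le_mul_of_nonneg_right hN hpi.le
  nlinarith [Real.pi_gt_three]
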